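/- arXiv:2312.02722 — 5 statements merged into one kernel-verified Lean document; each statement's English description precedes it below -/
import Mathlib

section
/- Let c ∈ ℝ and let s₁, s₂, s₃ be unit squares, each intersecting the horizontal line y = c, such that x(s₁) < x(s₂) < x(s₃), x(s₃) ≤ x(s₁) + 1, y(s₁) < y(s₂), and y(s₃) < y(s₂). Then every point of s₂ whose y-coordinate is at most c lies in s₁ ∪ s₃. -/
open Classical

/-- A unit square is the closed axis-parallel unit square with bottom-left corner `s`;
`InSq s p` says the point `p` lies in the square `s`. -/
def InSq (s p : ℝ × ℝ) : Prop :=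
  s.1 ≤ p.1 ∧ p.1 ≤ s.1 + 1 ∧ s.2 ≤ p.2 ∧ p.2 ≤ s.2 + 1

/-- A finite set `T` of unit squares covers a finite point set `P`. -/
def Covers (T P : Finset (ℝ × ℝ)) : Prop := ∀ p ∈ P, ∃ s ∈ T, InSq s p

/-- `q` is an exclusive point of the square `s` with respect to the set cover `Sstar`. -/
def ExclPt (Sstar : Finset (ℝ × ℝ)) (s q : ℝ × ℝ) : Prop :=
  InSq s q ∧ ∀ s' ∈ Sstar, InSq s' q → s' = s

/-- No square of `Sstar` is redundant with respect to `P`: every square of `Sstar`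
contains an exclusive point of `P`. -/
def NoRedundant (Sstar P : Finset (ℝ × ℝ)) : Prop :=
  ∀ s ∈ Sstar, ∃ q ∈ P, ExclPt Sstar s q

/-- The exclusive region of a square `s` with respect to `Sstar`. -/
def Excl (Sstar : Finset (ℝ × ℝ)) (s : ℝ × ℝ) : Set (ℝ × ℝ) :=
  {q | InSq s q ∧ ∀ s' ∈ Sstar, s' ≠ s → ¬ InSq s' q}

/-- The membership of `P'` with respect to `T`: the maximum over `p ∈ P'` of the number
of squares of `T` containing `p`. -/
noncomputable def memb (P' T : Finset (ℝ × ℝ)) : ℕ :=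
  P'.sup fun p => (T.filter fun s => InSq s p).card

/-- If `s₁, s₂, s₃` are unit squares intersecting the line `y = c` with
`x(s₁) < x(s₂) < x(s₃)`, `x(s₃) ≤ x(s₁)+1`, `y(s₁) < y(s₂)` and `y(s₃) < y(s₂)`,
then every point of `s₂` with y-coordinate at most `c` lies in `s₁ ∪ s₃`. -/
theorem stmt0 (c : ℝ) (s₁ s₂ s₃ : ℝ × ℝ)
    (h₁ : s₁.2 ≤ c ∧ c ≤ s₁.2 + 1)
    (h₂ : s₂.2 ≤ c ∧ c ≤ s₂.2 + 1)
    (h₃ : s₃.2 ≤ c ∧ c ≤ s₃.2 + 1)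
    (hx12 : s₁.1 < s₂.1) (hx23 : s₂.1 < s₃.1) (hx31 : s₃.1 ≤ s₁.1 + 1)
    (hy12 : s₁.2 < s₂.2) (hy32 : s₃.2 < s₂.2) :
    ∀ p : ℝ × ℝ, InSq s₂ p → p.2 ≤ c → InSq s₁ p ∨ InSq s₃ p := by
  rintro p ⟨hl, hr, hb, -⟩ hc
  rcases le_total p.1 (s₁.1 + 1) with h | h
  · exact Or.inl ⟨by linarith, h, by linarith, by linarith⟩
  · exact Or.inr ⟨by linarith, by linarith, by linarith, by linarith⟩
end

section
/- Let c ∈ ℝ, let P be a finite set of points in ℝ² each with y-coordinate at most c, and let S* be a finite set of unit squares, each intersecting the line y = c, that covers P and contains no redundant square. Then there do not exist squares t₁, t₂, t₃ ∈ S* with t₁ ∩ t₂ ∩ t₃ ≠ ∅ such that x(t₁) < x(t₂) < x(t₃), y(t₁) < y(t₂), and y(t₃) < y(t₂). (Consequently, in a set cover of a top-anchored line instance with no redundant squares, a composite clique must be of type DESC|ASC.) -/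
open Classical

/-- In a redundancy-free set cover of a top-anchored line instance there are
no three pairwise intersecting squares `t₁, t₂, t₃` (with a common point) such that
`x(t₁) < x(t₂) < x(t₃)`, `y(t₁) < y(t₂)` and `y(t₃) < y(t₂)`. -/
theorem stmt1 (c : ℝ) (P Sstar : Finset (ℝ × ℝ))
    (hP : ∀ p ∈ P, p.2 ≤ c)
    (hline : ∀ s ∈ Sstar, s.2 ≤ c ∧ c ≤ s.2 + 1)
    (hcov : Covers Sstar P)
    (hnr : NoRedundant Sstar P) :
    ¬ ∃ t₁ ∈ Sstar, ∃ t₂ ∈ Sstar, ∃ t₃ ∈ Sstar,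
        (∃ q : ℝ × ℝ, InSq t₁ q ∧ InSq t₂ q ∧ InSq t₃ q) ∧
        t₁.1 < t₂.1 ∧ t₂.1 < t₃.1 ∧ t₁.2 < t₂.2 ∧ t₃.2 < t₂.2 := by
  rintro ⟨t₁, h₁, t₂, h₂, t₃, h₃, ⟨r, hr₁, -, hr₃⟩, hx₁₂, hx₂₃, hy₁₂, hy₃₂⟩
  obtain ⟨q, hq, ⟨hqx, hqx', hqy, -⟩, hexcl⟩ := hnr t₂ h₂
  have hqc := hP q hq
  rcases le_total q.1 (t₁.1 + 1) with hle | hle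
  · have h := hexcl t₁ h₁
      ⟨by linarith, hle, by linarith, by linarith [(hline t₁ h₁).2]⟩
    exact hx₁₂.ne (congrArg Prod.fst h)
  · have h := hexcl t₃ h₃
      ⟨by linarith [hr₁.2.1, hr₃.1], by linarith, by linarith, by linarith [(hline t₃ h₃).2]⟩
    exact hx₂₃.ne' (congrArg Prod.fst h)
end

section
/- Let c ∈ ℝ, let P be a finite set of points in ℝ² each with y-coordinate at most c, and let S* be a finite set of unit squares, each intersecting the line y = c, that covers P, contains no redundant square, and whose squares have pairwise distinct y-coordinates of their bottom-left corners. Then for any squares s₁, …, s_k ∈ S* with x(s₁) < ⋯ < x(s_k) and s₁ ∩ ⋯ ∩ s_k ≠ ∅, there exists an index b ∈ {1, …, k} such that y(s₁) > ⋯ > y(s_b) and y(s_b) < ⋯ < y(s_k); i.e., every clique of S* is monotonic descending, monotonic ascending, or composite of type DESC|ASC. -/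
open Classical

/-- In a redundancy-free cover of points lying below the line `y = c`, among three intersecting
squares that meet the line, the horizontally middle one is not the strictly highest. -/
lemma not_middle_highest {c : ℝ} {P Sstar : Finset (ℝ × ℝ)}
    (hP : ∀ p ∈ P, p.2 ≤ c) (hline : ∀ s ∈ Sstar, s.2 ≤ c ∧ c ≤ s.2 + 1)
    (hnr : NoRedundant Sstar P) {l m r q : ℝ × ℝ}
    (hl : l ∈ Sstar) (hm : m ∈ Sstar) (hr : r ∈ Sstar)
    (hlm : l.1 < m.1) (hmr : m.1 < r.1) (hql : InSq l q) (hqr : InSq r q)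
    (hyl : l.2 < m.2) (hyr : r.2 < m.2) : False := by
  obtain ⟨p, hpP, ⟨hp₁, hp₂, hp₃, -⟩, hexcl⟩ := hnr m hm
  have hpc := hP p hpP
  have hpl : l.1 + 1 < p.1 := by
    by_contra! h
    have := hexcl l hl ⟨by linarith, h, by linarith, by linarith [(hline l hl).2]⟩
    exact hlm.ne (congrArg Prod.fst this)
  have hpr : p.1 < r.1 := by
    by_contra! h
    have := hexcl r hr ⟨h, by linarith, by linarith, by linarith [(hline r hr).2]⟩
    exact hmr.ne' (congrArg Prod.fst this)
  linarith [hql.2.1, hqr.1]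

/-- In a redundancy-free set cover of a top-anchored line instance whose squares
have pairwise distinct y-coordinates, every clique `s₁, …, s_k` (ordered by increasing
x-coordinate, with a common point) is descending, ascending, or composite DESC|ASC:
there is an index `b` such that y decreases on `{1, …, b}` and increases on `{b, …, k}`. -/
theorem stmt2 (c : ℝ) (P Sstar : Finset (ℝ × ℝ))
    (hP : ∀ p ∈ P, p.2 ≤ c)
    (hline : ∀ s ∈ Sstar, s.2 ≤ c ∧ c ≤ s.2 + 1)
    (hcov : Covers Sstar P)
    (hnr : NoRedundant Sstar P)
    (hdisty : ∀ a ∈ Sstar, ∀ b ∈ Sstar, a ≠ b → a.2 ≠ b.2)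
    (k : ℕ) (hk : 1 ≤ k) (s : ℕ → ℝ × ℝ)
    (hmem : ∀ i, 1 ≤ i → i ≤ k → s i ∈ Sstar)
    (hx : StrictMonoOn (fun i => (s i).1) (Set.Icc 1 k))
    (hint : ∃ q : ℝ × ℝ, ∀ i, 1 ≤ i → i ≤ k → InSq (s i) q) :
    ∃ b, 1 ≤ b ∧ b ≤ k ∧
      StrictAntiOn (fun i => (s i).2) (Set.Icc 1 b) ∧
      StrictMonoOn (fun i => (s i).2) (Set.Icc b k) := by
  obtain ⟨q, hq⟩ := hint
  have hne : ∀ i j, 1 ≤ i → i < j → j ≤ k → (s i).2 ≠ (s j).2 := fun i j hi hij hj =>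
    hdisty _ (hmem i hi (by omega)) _ (hmem j (by omega) hj) fun h =>
      (hx ⟨hi, by omega⟩ ⟨by omega, hj⟩ hij).ne (congrArg Prod.fst h)
  have hmid : ∀ i j l, 1 ≤ i → i < j → j < l → l ≤ k →
      (s i).2 < (s j).2 → (s l).2 < (s j).2 → False := fun i j l hi hij hjl hl =>
    not_middle_highest hP hline hnr (hmem i hi (by omega)) (hmem j (by omega) (by omega))
      (hmem l (by omega) hl) (hx ⟨hi, by omega⟩ ⟨by omega, by omega⟩ hij)
      (hx ⟨by omega, by omega⟩ ⟨by omega, hl⟩ hjl) (hq i hi (by omega)) (hq l (by omega) hl)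
  obtain ⟨b, hb, hmin⟩ := (Finset.Icc 1 k).exists_min_image (fun i => (s i).2)
    ⟨1, Finset.mem_Icc.2 ⟨le_rfl, hk⟩⟩
  simp only [Finset.mem_Icc] at hb hmin
  refine ⟨b, hb.1, hb.2, fun i hi j hj hij => ?_, fun i hi j hj hij => ?_⟩
  · by_contra! h
    have hlt : (s i).2 < (s j).2 := lt_of_le_of_ne h (hne i j hi.1 hij (hj.2.trans hb.2))
    have hbi := hmin i ⟨hi.1, hi.2.trans hb.2⟩
    have hjb : j ≠ b := by
      rintro rfl
      exact hlt.not_ge hbi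
    exact hmid i j b hi.1 hij (lt_of_le_of_ne hj.2 hjb) hb.2 hlt (hbi.trans_lt hlt)
  · by_contra! h
    have hlt : (s j).2 < (s i).2 :=
      lt_of_le_of_ne h (hne i j (hb.1.trans hi.1) hij hj.2).symm
    have hbj := hmin j ⟨hb.1.trans hj.1, hj.2⟩
    have hbi : b ≠ i := by
      rintro rfl
      exact hlt.not_ge hbj
    exact hmid b i j hb.1 (lt_of_le_of_ne hi.1 hbi) hij hj.2 (hbj.trans_lt hlt) hlt
end

section
/- Let S be a finite set of unit squares, let p ∈ ℝ², and let p₁, …, p_r be pairwise distinct points in ℝ². Let x : S → ℝ assign a nonnegative weight to each square. Assume: (i) every square of S that contains some p_j also contains p; (ii) no square of S contains more than two of the points p₁, …, p_r; and (iii) for every j ∈ {1, …, r}, the sum of x(s) over the squares s ∈ S containing p_j is at least 1/2. Then the sum of x(s) over the squares s ∈ S containing p is at least r/4. -/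
open Classical

/-- LP counting argument: if every square of `S` containing some `pt j` also
contains `p`, no square contains more than two of the `pt j`, and the fractional weight
covering each `pt j` is at least `1/2`, then the fractional weight covering `p` is at
least `r/4`. -/
theorem stmt12 (S : Finset (ℝ × ℝ)) (p : ℝ × ℝ) (r : ℕ) (pt : ℕ → ℝ × ℝ)
    (hdist : ∀ i, 1 ≤ i → i ≤ r → ∀ j, 1 ≤ j → j ≤ r → i ≠ j → pt i ≠ pt j)
    (x : ℝ × ℝ → ℝ) (hx0 : ∀ s ∈ S, 0 ≤ x s)
    (h1 : ∀ s ∈ S, (∃ j, 1 ≤ j ∧ j ≤ r ∧ InSq s (pt j)) → InSq s p)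
    (h2 : ∀ s ∈ S, ((Finset.Icc 1 r).filter fun j => InSq s (pt j)).card ≤ 2)
    (h3 : ∀ j, 1 ≤ j → j ≤ r →
        (1 : ℝ) / 2 ≤ ∑ u ∈ S.filter fun u => InSq u (pt j), x u) :
    (r : ℝ) / 4 ≤ ∑ u ∈ S.filter fun u => InSq u p, x u := by
  have hpt : ∑ j ∈ Finset.Icc 1 r, ((1 : ℝ) / 2) ≤
      ∑ j ∈ Finset.Icc 1 r, ∑ u ∈ S.filter fun u => InSq u (pt j), x u :=
    Finset.sum_le_sum fun j hj =>
      h3 j (Finset.mem_Icc.mp hj).1 (Finset.mem_Icc.mp hj).2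
  have hswap : ∑ j ∈ Finset.Icc 1 r, ∑ u ∈ S.filter (fun u => InSq u (pt j)), x u =
      ∑ u ∈ S, (((Finset.Icc 1 r).filter fun j => InSq u (pt j)).card : ℝ) * x u := by
    simp only [Finset.sum_filter]
    rw [Finset.sum_comm]
    refine Finset.sum_congr rfl fun u _ => ?_
    rw [← Finset.sum_filter, Finset.sum_const, nsmul_eq_mul]
  have hle : ∑ u ∈ S, (((Finset.Icc 1 r).filter fun j => InSq u (pt j)).card : ℝ) * x u ≤
      2 * ∑ u ∈ S.filter fun u => InSq u p, x u := by
    rw [Finset.mul_sum, Finset.sum_filter]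
    refine Finset.sum_le_sum fun u hu => ?_
    split_ifs with hp
    · exact mul_le_mul_of_nonneg_right (by exact_mod_cast h2 u hu) (hx0 u hu)
    · have hempty : (Finset.Icc 1 r).filter (fun j => InSq u (pt j)) = ∅ :=
        Finset.filter_eq_empty_iff.mpr fun j hj hju =>
          hp (h1 u hu ⟨j, (Finset.mem_Icc.mp hj).1, (Finset.mem_Icc.mp hj).2, hju⟩)
      simp [hempty]
  rw [Finset.sum_const, Nat.card_Icc, nsmul_eq_mul, Nat.add_sub_cancel] at hpt
  linarith
end

section
/- Let S be a finite set of unit squares, let p ∈ ℝ², let k be a natural number, and let p₁, …, p_r be pairwise distinct points in ℝ² with r ≥ k − 9. Assume: (i) every square of S that contains some p_j also contains p; (ii) no square of S contains more than two of the points p₁, …, p_r. Let x : S → ℝ assign a nonnegative weight to each square such that for every j the sum of x(s) over squares s ∈ S containing p_j is at least 1/2, and let y ∈ ℝ satisfy y ≥ sum of x(s) over squares s ∈ S containing p. Then k ≤ 4y + 9. -/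
open Classical

/-- Double counting: if each index `j ∈ J` receives total weight at least `c` from the elements of
`S` related to it, each element of `S` is related to at most `m` indices, and all such elements
satisfy `Q`, then `#J * c` is at most `m` times the weight of the elements satisfying `Q`. -/
theorem card_mul_le_mul_sum_filter {α ι : Type*} (S : Finset α) (J : Finset ι)
    (R : α → ι → Prop) (Q : α → Prop) (x : α → ℝ) (c : ℝ) (m : ℕ)
    (hQ : ∀ s ∈ S, (∃ j ∈ J, R s j) → Q s)
    (hm : ∀ s ∈ S, (J.filter fun j => R s j).card ≤ m)
    (hx : ∀ s ∈ S, 0 ≤ x s)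
    (hc : ∀ j ∈ J, c ≤ ∑ s ∈ S.filter fun s => R s j, x s) :
    J.card * c ≤ m * ∑ s ∈ S.filter Q, x s := by
  calc (J.card : ℝ) * c = ∑ _j ∈ J, c := by simp
    _ ≤ ∑ j ∈ J, ∑ s ∈ S.filter fun s => R s j, x s := Finset.sum_le_sum hc
    _ = ∑ s ∈ S, ((J.filter fun j => R s j).card : ℝ) * x s := by
      simp_rw [Finset.sum_filter]
      rw [Finset.sum_comm]
      refine Finset.sum_congr rfl fun s _ => ?_
      rw [← Finset.sum_filter, Finset.sum_const, nsmul_eq_mul]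
    _ ≤ ∑ s ∈ S, if Q s then m * x s else 0 := by
      refine Finset.sum_le_sum fun s hs => ?_
      split_ifs with h
      · exact mul_le_mul_of_nonneg_right (by exact_mod_cast hm s hs) (hx s hs)
      · have hempty : (J.filter fun j => R s j) = ∅ :=
          Finset.filter_eq_empty_iff.2 fun j hj hR => h (hQ s hs ⟨j, hj, hR⟩)
        simp [hempty]
    _ = m * ∑ s ∈ S.filter Q, x s := by
      rw [← Finset.sum_filter, Finset.mul_sum]

/-- If `r ≥ k - 9` and the hypotheses of the LP counting argument hold, and
`y` upper bounds the fractional weight covering `p`, then `k ≤ 4y + 9`. -/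
theorem stmt13 (S : Finset (ℝ × ℝ)) (p : ℝ × ℝ) (k r : ℕ) (pt : ℕ → ℝ × ℝ)
    (hr : k - 9 ≤ r)
    (hdist : ∀ i, 1 ≤ i → i ≤ r → ∀ j, 1 ≤ j → j ≤ r → i ≠ j → pt i ≠ pt j)
    (h1 : ∀ s ∈ S, (∃ j, 1 ≤ j ∧ j ≤ r ∧ InSq s (pt j)) → InSq s p)
    (h2 : ∀ s ∈ S, ((Finset.Icc 1 r).filter fun j => InSq s (pt j)).card ≤ 2)
    (x : ℝ × ℝ → ℝ) (hx0 : ∀ s ∈ S, 0 ≤ x s)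
    (h3 : ∀ j, 1 ≤ j → j ≤ r →
        (1 : ℝ) / 2 ≤ ∑ u ∈ S.filter fun u => InSq u (pt j), x u)
    (y : ℝ) (hy : ∑ u ∈ S.filter fun u => InSq u p, x u ≤ y) :
    (k : ℝ) ≤ 4 * y + 9 := by
  have hcount := card_mul_le_mul_sum_filter S (Finset.Icc 1 r) (fun s j => InSq s (pt j))
    (fun s => InSq s p) x (1 / 2) 2
    (fun s hs ⟨j, hj, hR⟩ =>
      h1 s hs ⟨j, (Finset.mem_Icc.1 hj).1, (Finset.mem_Icc.1 hj).2, hR⟩)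
    h2 hx0 (fun j hj => h3 j (Finset.mem_Icc.1 hj).1 (Finset.mem_Icc.1 hj).2)
  rw [Nat.card_Icc, Nat.add_sub_cancel] at hcount
  push_cast at hcount
  have hk : (k : ℝ) ≤ r + 9 := by
    have : k ≤ r + 9 := by omega
    exact_mod_cast this
  linarith
end
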